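/- Let f and ν satisfy the adapted coordinate conditions at a non-degenerate singular point p = (0,0) of the second kind as in the context, and assume additionally that f is a front near p: for every q in a neighborhood of p and every nonzero X ∈ ℝ², (D_X f(q), D_X ν(q)) ≠ (0,0). Then the Gaussian curvature K is bounded on the set of regular points in some neighborhood of p if and only if the limiting normal curvature κ_ν(u) := ⟨f_vv(u,0), ν(u,0)⟩/‖f_v(u,0)‖² vanishes for all u near 0. -/

import Mathlib

open scoped RealInnerProductSpace
open Filter

noncomputable section

/-- Euclidean 3-space. -/
abbrev E3 : Type := EuclideanSpace ℝ (Fin 3)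

/-- Partial derivative in the first (`u`) direction. -/
def pu {E : Type*} [NormedAddCommGroup E] [NormedSpace ℝ E] (f : ℝ × ℝ → E) (q : ℝ × ℝ) : E :=
  fderiv ℝ f q (1, 0)

/-- Partial derivative in the second (`v`) direction. -/
def pv {E : Type*} [NormedAddCommGroup E] [NormedSpace ℝ E] (f : ℝ × ℝ → E) (q : ℝ × ℝ) : E :=
  fderiv ℝ f q (0, 1)

/-- Determinant of three column vectors in `ℝ³`. -/
def det3 (a b c : E3) : ℝ :=
  Matrix.det !![a 0, b 0, c 0; a 1, b 1, c 1; a 2, b 2, c 2]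

/-- Cross product in `ℝ³`. -/
def cross3 (a b : E3) : E3 :=
  (WithLp.equiv 2 (Fin 3 → ℝ)).symm
    ![a 1 * b 2 - a 2 * b 1, a 2 * b 0 - a 0 * b 2, a 0 * b 1 - a 1 * b 0]

/-- Coefficients of the first fundamental form. -/
def Ec (f : ℝ × ℝ → E3) (q : ℝ × ℝ) : ℝ := ⟪pu f q, pu f q⟫
def Fc (f : ℝ × ℝ → E3) (q : ℝ × ℝ) : ℝ := ⟪pu f q, pv f q⟫
def Gc (f : ℝ × ℝ → E3) (q : ℝ × ℝ) : ℝ := ⟪pv f q, pv f q⟫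

/-- Coefficients of the second fundamental form. -/
def Lc (f ν : ℝ × ℝ → E3) (q : ℝ × ℝ) : ℝ := ⟪pu (pu f) q, ν q⟫
def Mc (f ν : ℝ × ℝ → E3) (q : ℝ × ℝ) : ℝ := ⟪pv (pu f) q, ν q⟫
def Nc (f ν : ℝ × ℝ → E3) (q : ℝ × ℝ) : ℝ := ⟪pv (pv f) q, ν q⟫

/-- The mean curvature `H = (E N − 2 F M + G L)/(2(E G − F²))`. -/
def meanCurv (f ν : ℝ × ℝ → E3) (q : ℝ × ℝ) : ℝ :=
  (Ec f q * Nc f ν q - 2 * Fc f q * Mc f ν q + Gc f q * Lc f ν q) /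
    (2 * (Ec f q * Gc f q - Fc f q ^ 2))

/-- The Gaussian curvature `K = (L N − M²)/(E G − F²)`. -/
def gaussCurv (f ν : ℝ × ℝ → E3) (q : ℝ × ℝ) : ℝ :=
  (Lc f ν q * Nc f ν q - Mc f ν q ^ 2) / (Ec f q * Gc f q - Fc f q ^ 2)

/-- Hadamard's lemma in the second variable, with a continuous quotient. -/
lemma exists_continuous_smul_eq_sub {E : Type*} [NormedAddCommGroup E] [NormedSpace ℝ E]
    [CompleteSpace E] {g : ℝ × ℝ → E} (hg : ContDiff ℝ 1 g) :
    ∃ k : ℝ × ℝ → E, Continuous k ∧ (∀ q : ℝ × ℝ, g q - g (q.1, 0) = q.2 • k q) ∧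
      ∀ u : ℝ, k (u, 0) = pv g (u, 0) := by
  have hc : Continuous (pv g) := (hg.continuous_fderiv one_ne_zero).clm_apply continuous_const
  refine ⟨fun q => ∫ t in (0 : ℝ)..1, pv g (q.1, t * q.2), ?_, ?_, ?_⟩
  · exact intervalIntegral.continuous_parametric_intervalIntegral_of_continuous'
      (f := fun (q : ℝ × ℝ) t => pv g (q.1, t * q.2)) (hc.comp (by fun_prop)) 0 1
  · intro q
    have hd : ∀ t : ℝ, HasDerivAt (fun t : ℝ => g (q.1, t * q.2)) (q.2 • pv g (q.1, t * q.2)) t := by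
      intro t
      have h1 : HasDerivAt (fun t : ℝ => (q.1, t * q.2)) ((0 : ℝ), 1 * q.2) t :=
        (hasDerivAt_const t q.1).prodMk ((hasDerivAt_id t).mul_const q.2)
      have h2 := ((hg.differentiable one_ne_zero) (q.1, t * q.2)).hasFDerivAt.comp_hasDerivAt t h1
      have h3 : ((0 : ℝ), 1 * q.2) = q.2 • ((0 : ℝ), (1 : ℝ)) := by ext <;> simp
      rw [h3, map_smul] at h2
      exact h2
    have hint := intervalIntegral.integral_eq_sub_of_hasDerivAt (a := 0) (b := 1)
      (fun t _ => hd t) (Continuous.intervalIntegrable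
        (continuous_const.smul (hc.comp (by fun_prop))) _ _)
    rw [intervalIntegral.integral_smul] at hint
    simpa using hint.symm
  · intro u
    simp

lemma gram_det_ne_zero_of_linearIndependent {E : Type*} [NormedAddCommGroup E] [InnerProductSpace ℝ E]
    {a b : E} (hab : LinearIndependent ℝ ![a, b]) : ⟪a, a⟫ * ⟪b, b⟫ - ⟪a, b⟫ ^ 2 ≠ 0 := by
  intro h
  have hz : ⟪⟪b, b⟫ • a + (-⟪a, b⟫) • b, ⟪b, b⟫ • a + (-⟪a, b⟫) • b⟫ = 0 := by
    simp only [inner_add_left, inner_add_right, real_inner_smul_left, real_inner_smul_right,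
      real_inner_comm a b]
    linear_combination ⟪b, b⟫ * h
  have h0 := (LinearIndependent.pair_iff.mp hab _ _ (inner_self_eq_zero.mp hz)).1
  exact hab.ne_zero 1 (inner_self_eq_zero.mp h0)

lemma eq_zero_of_inner_eq_zero_of_linearIndependent {a b n w : E3}
    (hab : LinearIndependent ℝ ![a, b]) (hn : n ≠ 0) (hna : ⟪n, a⟫ = 0) (hnb : ⟪n, b⟫ = 0)
    (hwn : ⟪n, w⟫ = 0) (hwa : ⟪a, w⟫ = 0) (hwb : ⟪b, w⟫ = 0) : w = 0 := by
  have hli : LinearIndependent ℝ ![n, a, b] := by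
    refine LinearIndependent.finCons' _ _ hab fun x y hy hxy => ?_
    have hny : ⟪n, y⟫ = 0 := by
      obtain ⟨s, t, hst⟩ := Submodule.mem_span_pair.mp
        (by simpa [Matrix.range_cons, Set.pair_comm] using hy :
          y ∈ Submodule.span ℝ {a, b})
      rw [← hst, inner_add_right, real_inner_smul_right, real_inner_smul_right, hna, hnb]
      ring
    have h := congrArg (fun z => ⟪n, z⟫) hxy
    simp only [inner_add_right, real_inner_smul_right, hny, add_zero, inner_zero_right] at h
    exact (mul_eq_zero.mp h).resolve_right fun h => hn (inner_self_eq_zero.mp h)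
  have htop := hli.span_eq_top_of_card_eq_finrank (by simp)
  have hle : Submodule.span ℝ (Set.range ![n, a, b]) ≤ (ℝ ∙ w)ᗮ := by
    rw [Submodule.span_le]
    rintro _ ⟨i, rfl⟩
    rw [SetLike.mem_coe, Submodule.mem_orthogonal_singleton_iff_inner_left]
    fin_cases i <;> simpa
  have hw := hle (htop ▸ Submodule.mem_top : w ∈ _)
  rw [Submodule.mem_orthogonal_singleton_iff_inner_left] at hw
  exact inner_self_eq_zero.mp hw

/-- Differentiating an orthogonality relation. -/
lemma inner_fderiv_eq_neg_of_inner_eq_zero {g ν : ℝ × ℝ → E3} (hg : Differentiable ℝ g)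
    (hν : Differentiable ℝ ν) (h : ∀ q, ⟪ν q, g q⟫ = 0) (q X : ℝ × ℝ) :
    ⟪fderiv ℝ g q X, ν q⟫ = -⟪g q, fderiv ℝ ν q X⟫ := by
  have h1 := fderiv_inner_apply ℝ (hν q) (hg q) X
  rw [funext h] at h1
  simp only [fderiv_fun_const, Pi.zero_apply, _root_.zero_apply] at h1
  rw [real_inner_comm (ν q), real_inner_comm (fderiv ℝ ν q X)]
  linarith

lemma pv_pu_eq_pu_pv {f : ℝ × ℝ → E3} (hf : ContDiff ℝ 2 f) (q : ℝ × ℝ) :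
    pv (pu f) q = pu (pv f) q := by
  have hd : DifferentiableAt ℝ (fderiv ℝ f) q :=
    (hf.fderiv_right (m := 1) (by norm_num)).differentiable one_ne_zero q
  have hs : IsSymmSndFDerivAt ℝ f q := hf.contDiffAt.isSymmSndFDerivAt (by simp)
  have h (X Y : ℝ × ℝ) : fderiv ℝ (fun p => fderiv ℝ f p X) q Y = fderiv ℝ (fderiv ℝ f) q Y X := by
    rw [fderiv_clm_apply hd (differentiableAt_const X)]
    simp
  exact (h _ _).trans ((hs.eq _ _).trans (h _ _).symm)

lemma contDiff_pu {E : Type*} [NormedAddCommGroup E] [NormedSpace ℝ E] {f : ℝ × ℝ → E}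
    (hf : ContDiff ℝ (⊤ : ℕ∞) f) : ContDiff ℝ (⊤ : ℕ∞) (pu f) :=
  (hf.fderiv_right (m := (⊤ : ℕ∞)) (by simp)).clm_apply contDiff_const

lemma contDiff_pv {E : Type*} [NormedAddCommGroup E] [NormedSpace ℝ E] {f : ℝ × ℝ → E}
    (hf : ContDiff ℝ (⊤ : ℕ∞) f) : ContDiff ℝ (⊤ : ℕ∞) (pv f) :=
  (hf.fderiv_right (m := (⊤ : ℕ∞)) (by simp)).clm_apply contDiff_const

/-- If a quantity `K` satisfies `v² D K = -(v A N + v² B²)` for continuous `A`, `B`, `D`, with `A`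
and `D` nonvanishing at the origin, then `K` is bounded off the axis `v = 0` near the origin exactly
when `N` vanishes along that axis. -/
lemma exists_bound_iff_eventually_eq_zero {A B D N K : ℝ × ℝ → ℝ} (hA : Continuous A)
    (hB : Continuous B) (hD : Continuous D) (hN : ContDiff ℝ 1 N)
    (hA0 : A (0, 0) ≠ 0) (hD0 : D (0, 0) ≠ 0)
    (hK : ∀ᶠ q in nhds ((0, 0) : ℝ × ℝ), q.2 ≠ 0 →
      K q = -(q.2 * A q * N q + q.2 ^ 2 * B q ^ 2) / (q.2 ^ 2 * D q)) :
    (∃ C : ℝ, ∀ᶠ q in nhds ((0, 0) : ℝ × ℝ), q.2 ≠ 0 → |K q| ≤ C) ↔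
      ∀ᶠ u in nhds (0 : ℝ), N (u, 0) = 0 := by
  have hDe : ∀ᶠ q in nhds ((0, 0) : ℝ × ℝ), D q ≠ 0 := hD.continuousAt.eventually_ne hD0
  have hAe : ∀ᶠ q in nhds ((0, 0) : ℝ × ℝ), A q ≠ 0 := hA.continuousAt.eventually_ne hA0
  have haxis : Tendsto (fun u : ℝ => (u, (0 : ℝ))) (nhds 0) (nhds (0, 0)) :=
    (by fun_prop : Continuous fun u : ℝ => (u, (0 : ℝ))).tendsto 0
  constructor
  · rintro ⟨C, hC⟩
    have hbound : ∀ᶠ q in nhds ((0, 0) : ℝ × ℝ), q.2 ≠ 0 →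
        |A q * N q| ≤ |q.2| * (|D q| * C + B q ^ 2) := by
      filter_upwards [hC, hK, hDe] with q hCq hKq hDq hv
      have hid : A q * N q = -(q.2 * (D q * K q + B q ^ 2)) := by
        rw [hKq hv]
        field_simp
        ring
      rw [hid, abs_neg, abs_mul]
      gcongr
      calc |D q * K q + B q ^ 2| ≤ |D q * K q| + |B q ^ 2| := abs_add_le _ _
        _ = |D q| * |K q| + B q ^ 2 := by rw [abs_mul, abs_of_nonneg (sq_nonneg (B q))]
        _ ≤ |D q| * C + B q ^ 2 := by gcongr; exact hCq hv
    filter_upwards [haxis.eventually hbound.eventually_nhds, haxis.eventually hAe] with u hu hAu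
    have hline : Continuous fun v : ℝ => (u, v) := by fun_prop
    have hev : ∀ᶠ v in nhdsWithin (0 : ℝ) {0}ᶜ, |A (u, v) * N (u, v)| ≤
        |v| * (|D (u, v)| * C + B (u, v) ^ 2) := by
      filter_upwards [((hline.tendsto 0).eventually hu).filter_mono nhdsWithin_le_nhds,
        self_mem_nhdsWithin] with v hv hv0 using hv hv0
    have hNc := hN.continuous
    have hle := le_of_tendsto_of_tendsto
      (((by fun_prop : Continuous fun v : ℝ => |A (u, v) * N (u, v)|).tendsto 0).mono_left
        nhdsWithin_le_nhds)
      (((by fun_prop : Continuous fun v : ℝ =>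
        |v| * (|D (u, v)| * C + B (u, v) ^ 2)).tendsto 0).mono_left nhdsWithin_le_nhds) hev
    rw [abs_zero, zero_mul, abs_nonpos_iff] at hle
    exact (mul_eq_zero.mp hle).resolve_left hAu
  · intro h
    obtain ⟨k, hk, hkN, -⟩ := exists_continuous_smul_eq_sub hN
    have hcont : ContinuousAt (fun q => |-(A q * k q + B q ^ 2) / D q|) (0, 0) :=
      ((by fun_prop : Continuous fun q => -(A q * k q + B q ^ 2)).continuousAt.div
        hD.continuousAt hD0).abs
    refine ⟨|-(A (0, 0) * k (0, 0) + B (0, 0) ^ 2) / D (0, 0)| + 1, ?_⟩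
    have hfst : Tendsto Prod.fst (nhds ((0, 0) : ℝ × ℝ)) (nhds (0 : ℝ)) := continuous_fst.tendsto _
    filter_upwards [hK, hDe, hfst.eventually h, hcont.eventually_le_const (lt_add_one _)]
      with q hKq hDq hNq hle hv
    have hNk : N q = q.2 * k q := by simpa [hNq] using hkN q
    have hid : K q = -(A q * k q + B q ^ 2) / D q := by
      rw [hKq hv, hNk]
      field_simp
    rwa [hid]

lemma inner_fderiv_eq_zero_of_norm_eq_one {ν : ℝ × ℝ → E3} (hν : Differentiable ℝ ν)
    (h : ∀ q, ‖ν q‖ = 1) (q X : ℝ × ℝ) : ⟪ν q, fderiv ℝ ν q X⟫ = 0 := by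
  have h1 := fderiv_inner_apply ℝ (hν q) (hν q) X
  have h2 : (fun t => ⟪ν t, ν t⟫) = fun _ => (1 : ℝ) := by
    funext t
    rw [real_inner_self_eq_norm_sq, h, one_pow]
  rw [h2] at h1
  simp only [fderiv_fun_const, Pi.zero_apply, _root_.zero_apply,
    real_inner_comm (ν q) (fderiv ℝ ν q X)] at h1
  linarith

/-- At a non-degenerate singular point of the second kind of a front, the Gaussian curvature
is bounded on the regular points of some neighborhood of the origin if and only if the
limiting normal curvature `κ_ν(u) = ⟨f_vv, ν⟩/‖f_v‖²` at `(u,0)` vanishes for all `u`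
near `0`. -/
theorem second_kind_gauss_bounded_iff_limiting_normal_curvature_vanishes
    (f ν : ℝ × ℝ → E3) (ε : ℝ → ℝ)
    (hf : ContDiff ℝ (⊤ : ℕ∞) f) (hν : ContDiff ℝ (⊤ : ℕ∞) ν)
    (hfrontal : ∀ q : ℝ × ℝ, ‖ν q‖ = 1 ∧ ⟪ν q, pu f q⟫ = 0 ∧ ⟪ν q, pv f q⟫ = 0)
    (hε : ContDiff ℝ (⊤ : ℕ∞) ε) (hε0 : ε 0 = 0)
    (hfu0 : pu f (0, 0) = 0) (hfv1 : ‖pv f (0, 0)‖ = 1)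
    (hnull : ∀ᶠ u in nhds (0 : ℝ), pu f (u, 0) + ε u • pv f (u, 0) = 0)
    (hnd : LinearIndependent ℝ ![pv (pu f) (0, 0), pv f (0, 0)])
    (hreg : ∀ᶠ q in nhds ((0, 0) : ℝ × ℝ), q.2 ≠ 0 → Ec f q * Gc f q - Fc f q ^ 2 ≠ 0)
    (hfront : ∀ᶠ q in nhds ((0, 0) : ℝ × ℝ), ∀ X : ℝ × ℝ, X ≠ 0 →
      ¬(fderiv ℝ f q X = 0 ∧ fderiv ℝ ν q X = 0)) :
    (∃ (W : Set (ℝ × ℝ)) (C : ℝ), IsOpen W ∧ (0, 0) ∈ W ∧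
        ∀ q ∈ W, Ec f q * Gc f q - Fc f q ^ 2 ≠ 0 → |gaussCurv f ν q| ≤ C) ↔
      (∀ᶠ u in nhds (0 : ℝ),
        ⟪pv (pv f) (u, 0), ν (u, 0)⟫ / ‖pv f (u, 0)‖ ^ 2 = 0) := by
  have hfu := contDiff_pu hf
  have hfv := contDiff_pv hf
  have h1 : (1 : WithTop ℕ∞) ≤ ((⊤ : ℕ∞) : WithTop ℕ∞) := by exact_mod_cast le_top
  have h2 : (2 : WithTop ℕ∞) ≤ ((⊤ : ℕ∞) : WithTop ℕ∞) := by
    exact WithTop.coe_le_coe.mpr (le_top : (2 : ℕ∞) ≤ ⊤)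
  have hdν : Differentiable ℝ ν := (hν.of_le h1).differentiable one_ne_zero
  have hdfu : Differentiable ℝ (pu f) := (hfu.of_le h1).differentiable one_ne_zero
  have hdfv : Differentiable ℝ (pv f) := (hfv.of_le h1).differentiable one_ne_zero
  have hL (q) : Lc f ν q = -⟪pu f q, pu ν q⟫ :=
    inner_fderiv_eq_neg_of_inner_eq_zero hdfu hdν (fun q => (hfrontal q).2.1) q _
  have hM (q) : Mc f ν q = -⟪pu f q, pv ν q⟫ :=
    inner_fderiv_eq_neg_of_inner_eq_zero hdfu hdν (fun q => (hfrontal q).2.1) q _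
  have hM' (q) : Mc f ν q = -⟪pv f q, pu ν q⟫ := by
    rw [Mc, pv_pu_eq_pu_pv (hf.of_le h2)]
    exact inner_fderiv_eq_neg_of_inner_eq_zero hdfv hdν (fun q => (hfrontal q).2.2) q _
  have hN (q) : Nc f ν q = -⟪pv f q, pv ν q⟫ :=
    inner_fderiv_eq_neg_of_inner_eq_zero hdfv hdν (fun q => (hfrontal q).2.2) q _
  have hεc : ContDiff ℝ (⊤ : ℕ∞) fun q : ℝ × ℝ => ε q.1 := hε.comp contDiff_fst
  obtain ⟨k, hk, hkξ, hk0⟩ := exists_continuous_smul_eq_sub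
    (g := fun q => pu f q + ε q.1 • pv f q) ((hfu.add (hεc.smul hfv)).of_le h1)
  have hfst : Tendsto Prod.fst (nhds ((0, 0) : ℝ × ℝ)) (nhds (0 : ℝ)) := continuous_fst.tendsto _
  have hξ : ∀ᶠ q in nhds ((0, 0) : ℝ × ℝ), pu f q = q.2 • k q - ε q.1 • pv f q := by
    filter_upwards [hfst.eventually hnull] with q hq
    have := hkξ q
    simp only [hq, sub_zero] at this
    rw [← this, add_sub_cancel_right]
  have hk00 : k (0, 0) = pv (pu f) (0, 0) := by
    have hdε : DifferentiableAt ℝ (fun q : ℝ × ℝ => ε q.1) (0, 0) :=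
      (hεc.of_le h1).differentiable one_ne_zero _
    have hεv : fderiv ℝ (fun q : ℝ × ℝ => ε q.1) (0, 0) (0, 1) = 0 := by
      have hdε1 : DifferentiableAt ℝ ε ((0, 0) : ℝ × ℝ).1 :=
        (hε.of_le h1).differentiable one_ne_zero _
      have hcomp := fderiv_comp ((0, 0) : ℝ × ℝ) hdε1 differentiableAt_fst
      rw [show (fun q : ℝ × ℝ => ε q.1) = ε ∘ Prod.fst from rfl, hcomp]
      simp [fderiv_fst]
    rw [hk0, pv, fderiv_fun_add (hdfu _) (hdε.fun_smul (hdfv _)), fderiv_fun_smul hdε (hdfv _)]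
    simp [hε0, hεv, pv]
  have hfvc := hfv.continuous
  have hνu := (contDiff_pu hν).continuous
  have hνv := (contDiff_pv hν).continuous
  have hεq := hεc.continuous
  set A : ℝ × ℝ → ℝ := fun q => ⟪k q, pu ν q + ε q.1 • pv ν q⟫ with hA
  set B : ℝ × ℝ → ℝ := fun q => ⟪k q, pv ν q⟫ with hB
  set D : ℝ × ℝ → ℝ := fun q => ⟪k q, k q⟫ * ⟪pv f q, pv f q⟫ - ⟪k q, pv f q⟫ ^ 2 with hD
  have hEFG : ∀ᶠ q in nhds ((0, 0) : ℝ × ℝ), Ec f q * Gc f q - Fc f q ^ 2 = q.2 ^ 2 * D q := by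
    filter_upwards [hξ] with q hq
    simp only [Ec, Fc, Gc, hD, hq, inner_sub_left, inner_sub_right, real_inner_smul_left,
      real_inner_smul_right, real_inner_comm (k q) (pv f q)]
    ring
  have hLMN : ∀ᶠ q in nhds ((0, 0) : ℝ × ℝ), Lc f ν q * Nc f ν q - Mc f ν q ^ 2 =
      -(q.2 * A q * Nc f ν q + q.2 ^ 2 * B q ^ 2) := by
    filter_upwards [hξ] with q hq
    have hLq := hL q
    have hMq := hM q
    have hMq' := hM' q
    have hNq := hN q
    rw [hq, inner_sub_left, real_inner_smul_left, real_inner_smul_left] at hLq hMq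
    have hAq : q.2 * A q = -(Lc f ν q + 2 * ε q.1 * Mc f ν q + ε q.1 ^ 2 * Nc f ν q) := by
      simp only [hA, inner_add_right, real_inner_smul_right]
      linear_combination hLq + ε q.1 * hMq' + ε q.1 * hMq + ε q.1 ^ 2 * hNq
    have hBq : q.2 * B q = -(Mc f ν q + ε q.1 * Nc f ν q) := by
      simp only [hB]
      linear_combination hMq + ε q.1 * hNq
    rw [← mul_pow, hAq, hBq]
    ring
  have hD0 : D (0, 0) ≠ 0 := by
    simp only [hD, hk00]
    exact gram_det_ne_zero_of_linearIndependent hnd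
  have hA0 : A (0, 0) ≠ 0 := by
    intro h
    simp only [hA, hε0, zero_smul, add_zero, hk00] at h
    have hfr := hfront.self_of_nhds (1, 0) (by simp)
    refine hfr ⟨hfu0, eq_zero_of_inner_eq_zero_of_linearIndependent (n := ν (0, 0)) hnd ?_ ?_
      (hfrontal _).2.2 ?_ h ?_⟩
    · exact norm_ne_zero_iff.mp (by rw [(hfrontal _).1]; exact one_ne_zero)
    · have := hM (0, 0)
      rwa [hfu0, inner_zero_left, neg_zero, Mc, real_inner_comm] at this
    · exact inner_fderiv_eq_zero_of_norm_eq_one hdν (fun q => (hfrontal q).1) _ _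
    · have := (hM' (0, 0)).symm.trans (hM (0, 0))
      rw [hfu0, inner_zero_left, neg_inj] at this
      exact this
  have hNsmooth : ContDiff ℝ 1 (Nc f ν) := ((contDiff_pv hfv).inner ℝ hν).of_le h1
  have hkey := exists_bound_iff_eventually_eq_zero (A := A) (B := B) (D := D) (N := Nc f ν)
    (K := gaussCurv f ν) (by fun_prop) (by fun_prop) (by fun_prop) hNsmooth hA0 hD0 (by
      filter_upwards [hEFG, hLMN] with q hq hq' _
      rw [gaussCurv, hq, hq'])
  have hleft : (∃ (W : Set (ℝ × ℝ)) (C : ℝ), IsOpen W ∧ (0, 0) ∈ W ∧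
        ∀ q ∈ W, Ec f q * Gc f q - Fc f q ^ 2 ≠ 0 → |gaussCurv f ν q| ≤ C) ↔
      ∃ C : ℝ, ∀ᶠ q in nhds ((0, 0) : ℝ × ℝ), q.2 ≠ 0 → |gaussCurv f ν q| ≤ C := by
    constructor
    · rintro ⟨W, C, hW, h0, hC⟩
      refine ⟨C, ?_⟩
      filter_upwards [hW.mem_nhds h0, hreg] with q hq hr hv using hC q hq (hr hv)
    · rintro ⟨C, hC⟩
      obtain ⟨W, hWC, hW, h0⟩ := eventually_nhds_iff.mp (hC.and hEFG)
      refine ⟨W, C, hW, h0, fun q hq hr => (hWC q hq).1 fun hv => hr ?_⟩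
      rw [(hWC q hq).2, hv]
      ring
  have hright : ∀ᶠ u in nhds (0 : ℝ), ‖pv f (u, 0)‖ ^ 2 ≠ 0 := by
    refine (by fun_prop : Continuous fun u : ℝ => ‖pv f (u, 0)‖ ^ 2).continuousAt.eventually_ne ?_
    rw [hfv1]
    norm_num
  rw [hleft, hkey]
  refine eventually_congr ?_
  filter_upwards [hright] with u hu
  rw [div_eq_zero_iff, or_iff_left hu, Nc]
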